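/- arXiv:1806.05358 — 8 statements merged into one kernel-verified Lean document; each statement's English description precedes it below -/
import Mathlib

section
/- Let F : ℝ^d → ℝ be L-smooth, let Δ ≥ 0, η = 1/L, and let w_0, w_1, …, w_t be a Δ-inexact gradient descent sequence for F with step size η (i.e., w_{τ+1} = w_τ − η·g_τ with ‖g_τ − ∇F(w_τ)‖ ≤ Δ for all τ < t). Then F(w_0) − F(w_t) ≥ (L/(4t))·‖w_0 − w_t‖² − Δ²·t/L. -/
lemma descent_aux {E : Type*} [NormedAddCommGroup E] [InnerProductSpace ℝ E] [CompleteSpace E]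
    (F : E → ℝ) (L : ℝ) (hdiff : Differentiable ℝ F)
    (hsmooth : ∀ x y : E, ‖gradient F x - gradient F y‖ ≤ L * ‖x - y‖) (x v : E) :
    F (x + v) ≤ F x + inner ℝ (gradient F x) v + L / 2 * ‖v‖ ^ 2 := by
  have hd : ∀ s : ℝ, HasDerivAt
      (fun s : ℝ => F (x + s • v) - s * inner ℝ (gradient F x) v - s ^ 2 * (L / 2 * ‖v‖ ^ 2))
      (inner ℝ (gradient F (x + s • v)) v - inner ℝ (gradient F x) v
        - 2 * s * (L / 2 * ‖v‖ ^ 2)) s := by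
    intro s
    have h1 : HasDerivAt (fun s : ℝ => x + s • v) v s := by
      simpa using ((hasDerivAt_id s).smul_const v).const_add x
    have h2 := (hdiff (x + s • v)).hasGradientAt.hasFDerivAt.comp_hasDerivAt s h1
    have h3 := (hasDerivAt_id s).mul_const (inner ℝ (gradient F x) v)
    have h4 := (hasDerivAt_pow 2 s).mul_const (L / 2 * ‖v‖ ^ 2)
    have h5 := (h2.sub h3).sub h4
    convert h5 using 1
    · rfl
    · rfl
    · rfl
    · simp
  have hanti := antitoneOn_of_deriv_nonpos (convex_Icc (0 : ℝ) 1)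
    (fun s _ => (hd s).continuousAt.continuousWithinAt)
    (fun s _ => (hd s).differentiableAt.differentiableWithinAt)
    (fun s hs => by
      rw [interior_Icc] at hs
      rw [(hd s).deriv, ← inner_sub_left]
      have h1 := real_inner_le_norm (gradient F (x + s • v) - gradient F x) v
      have h2 := hsmooth (x + s • v) x
      rw [add_sub_cancel_left, norm_smul, Real.norm_of_nonneg hs.1.le] at h2
      have h3 := mul_le_mul_of_nonneg_right h2 (norm_nonneg v)
      nlinarith)
  have := hanti (show (0 : ℝ) ∈ Set.Icc 0 1 by simp) (show (1 : ℝ) ∈ Set.Icc 0 1 by simp)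
    zero_le_one
  simp at this ⊢
  linarith

/-- Along a `Δ`-inexact gradient descent sequence with step size `η = 1/L`
on an `L`-smooth function, the function decrease is bounded below in terms of the total
distance moved. -/
theorem inexact_gd_function_decrease
    (d : ℕ) (F : EuclideanSpace ℝ (Fin d) → ℝ) (L Δ : ℝ)
    (hL : 0 < L) (hΔ : 0 ≤ Δ)
    (hdiff : Differentiable ℝ F)
    (hsmooth : ∀ x y : EuclideanSpace ℝ (Fin d),
      ‖gradient F x - gradient F y‖ ≤ L * ‖x - y‖)
    (t : ℕ) (w g : ℕ → EuclideanSpace ℝ (Fin d))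
    (hseq : ∀ τ < t, ‖g τ - gradient F (w τ)‖ ≤ Δ ∧
      w (τ + 1) = w τ - (1 / L) • g τ) :
    F (w 0) - F (w t) ≥ L / (4 * t) * ‖w 0 - w t‖ ^ 2 - Δ ^ 2 * t / L := by
  have hstep : ∀ τ < t, L / 4 * ‖w τ - w (τ + 1)‖ ^ 2 - Δ ^ 2 / L ≤ F (w τ) - F (w (τ + 1)) := by
    intro τ hτ
    obtain ⟨he, hw⟩ := hseq τ hτ
    set v := w (τ + 1) - w τ with hv
    have hg : g τ = (-L) • v := by
      rw [hv, hw, sub_sub_cancel_left, smul_neg, neg_smul, neg_neg, smul_smul,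
        mul_one_div_cancel hL.ne', one_smul]
    have h1 := descent_aux F L hdiff hsmooth (w τ) v
    rw [show w τ + v = w (τ + 1) by rw [hv]; abel] at h1
    have h2 : inner ℝ (gradient F (w τ)) v
        = -L * ‖v‖ ^ 2 - inner ℝ (g τ - gradient F (w τ)) v := by
      rw [inner_sub_left, hg, real_inner_smul_left, real_inner_self_eq_norm_sq]; ring
    have h3 := (abs_le.1 ((abs_real_inner_le_norm (g τ - gradient F (w τ)) v).trans
      (mul_le_mul_of_nonneg_right he (norm_nonneg v)))).1
    have h4 : Δ * ‖v‖ ≤ L / 4 * ‖v‖ ^ 2 + Δ ^ 2 / L := by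
      have : L / 4 * ‖v‖ ^ 2 + Δ ^ 2 / L - Δ * ‖v‖ = (L * ‖v‖ / 2 - Δ) ^ 2 / L := by
        field_simp; ring
      have h5 : 0 ≤ (L * ‖v‖ / 2 - Δ) ^ 2 / L := by positivity
      linarith
    rw [norm_sub_rev, ← hv]
    linarith
  have hsum := Finset.sum_le_sum (fun τ hτ => hstep τ (Finset.mem_range.1 hτ))
  rw [Finset.sum_range_sub' (fun i => F (w i)), Finset.sum_sub_distrib, ← Finset.mul_sum,
    Finset.sum_const, Finset.card_range, nsmul_eq_mul] at hsum
  rcases Nat.eq_zero_or_pos t with rfl | ht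
  · simp
  have ht' : (0 : ℝ) < t := by exact_mod_cast ht
  have hn : ‖w 0 - w t‖ ≤ ∑ i ∈ Finset.range t, ‖w i - w (i + 1)‖ := by
    rw [← Finset.sum_range_sub' w]
    exact norm_sum_le _ _
  have hcs := sq_sum_le_card_mul_sum_sq (s := Finset.range t) (f := fun i => ‖w i - w (i + 1)‖)
  rw [Finset.card_range] at hcs
  have h6 : ‖w 0 - w t‖ ^ 2 ≤ t * ∑ i ∈ Finset.range t, ‖w i - w (i + 1)‖ ^ 2 :=
    (pow_le_pow_left₀ (norm_nonneg _) hn 2).trans hcs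
  have h7 : L / (4 * t) * ‖w 0 - w t‖ ^ 2
      ≤ L / (4 * t) * (t * ∑ i ∈ Finset.range t, ‖w i - w (i + 1)‖ ^ 2) :=
    mul_le_mul_of_nonneg_left h6 (by positivity)
  have h8 : L / (4 * t) * (t * ∑ i ∈ Finset.range t, ‖w i - w (i + 1)‖ ^ 2)
      = L / 4 * ∑ i ∈ Finset.range t, ‖w i - w (i + 1)‖ ^ 2 := by
    field_simp
  have h9 : (t : ℝ) * (Δ ^ 2 / L) = Δ ^ 2 * t / L := by ring
  linarith
end

section
/- Let η, γ, ρ, R, r, μ, Δ > 0 satisfy η·γ ≤ 1, R ≥ μ, Δ ≤ ρ(R+r)μ, and γ ≥ 24·ρ(R+r)·log_{9/4}(2(R+r)/μ), and let T = (2/(ηγ))·log_{9/4}(2(R+r)/μ) (assumed to be a positive integer). Suppose ψ_0, ψ_1, … and φ_0, φ_1, … are nonnegative real sequences with ψ_0 ≥ μ, φ_0 = 0, and for all t, ψ_{t+1} ≥ (1+ηγ)ψ_t − 2ηρ(R+r)·√(ψ_t² + φ_t²) − 2ηΔ and φ_{t+1} ≤ (1+ηγ)φ_t + 2ηρ(R+r)·√(ψ_t²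 + φ_t²) + 2ηΔ. Then for every t ≤ T one has ψ_t ≥ (1 + ηγ/2)·ψ_{t−1} and φ_t ≤ (t/T)·ψ_t; in particular ψ_T ≥ (1 + ηγ/2)^T · ψ_0 ≥ 2(R + r). -/
/-- The coupled recursion controlling the projections of the difference of two
inexact gradient descent sequences onto the negative-curvature direction (`ψ`) and its
orthogonal complement (`φ`): `ψ` grows geometrically and dominates `φ`, so that after
`T = (2/(ηγ))·log_{9/4}(2(R+r)/μ)` steps one has `ψ_T ≥ (1+ηγ/2)^T ψ_0 ≥ 2(R+r)`. -/
theorem coupled_recursion_escape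
    (η γ ρ R r μ Δ : ℝ)
    (hη : 0 < η) (hγ : 0 < γ) (hρ : 0 < ρ) (hR : 0 < R) (hr : 0 < r)
    (hμ : 0 < μ) (hΔ : 0 < Δ)
    (hηγ : η * γ ≤ 1) (hRμ : R ≥ μ) (hΔle : Δ ≤ ρ * (R + r) * μ)
    (hγge : γ ≥ 24 * ρ * (R + r) * Real.logb (9 / 4) (2 * (R + r) / μ))
    (T : ℕ) (hT : 0 < T)
    (hTval : (T : ℝ) = 2 / (η * γ) * Real.logb (9 / 4) (2 * (R + r) / μ))
    (ψ φ : ℕ → ℝ)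
    (hψ0 : ψ 0 ≥ μ) (hφ0 : φ 0 = 0)
    (hψnn : ∀ t, 0 ≤ ψ t) (hφnn : ∀ t, 0 ≤ φ t)
    (hψrec : ∀ t, ψ (t + 1) ≥ (1 + η * γ) * ψ t
      - 2 * η * ρ * (R + r) * Real.sqrt (ψ t ^ 2 + φ t ^ 2) - 2 * η * Δ)
    (hφrec : ∀ t, φ (t + 1) ≤ (1 + η * γ) * φ t
      + 2 * η * ρ * (R + r) * Real.sqrt (ψ t ^ 2 + φ t ^ 2) + 2 * η * Δ) :
    (∀ t, 1 ≤ t → t ≤ T → ψ t ≥ (1 + η * γ / 2) * ψ (t - 1)) ∧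
    (∀ t ≤ T, φ t ≤ (t / T : ℝ) * ψ t) ∧
    ψ T ≥ (1 + η * γ / 2) ^ T * ψ 0 ∧
    (1 + η * γ / 2) ^ T * ψ 0 ≥ 2 * (R + r) := by
  have hS : 0 < R + r := by linarith
  set L := Real.logb (9 / 4) (2 * (R + r) / μ) with hL
  have hQ : 2 ≤ 2 * (R + r) / μ := by
    rw [le_div_iff₀ hμ]; linarith
  have hLhalf : 1 / 2 ≤ L := by
    rw [hL, Real.le_logb_iff_rpow_le (by norm_num) (by linarith)]
    have h := rpow_one_add_le_one_add_mul_self (s := (5 / 4 : ℝ)) (p := 1 / 2)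
      (by norm_num) (by norm_num) (by norm_num)
    norm_num at h ⊢
    linarith
  obtain ⟨x, hx⟩ : ∃ x, x = η * γ := ⟨_, rfl⟩
  obtain ⟨a, ha⟩ : ∃ a, a = η * ρ * (R + r) := ⟨_, rfl⟩
  have hx0 : 0 < x := by rw [hx]; positivity
  have ha0 : 0 < a := by rw [ha]; positivity
  have hT0 : (0 : ℝ) < T := by exact_mod_cast hT
  have hTx : T * x = 2 * L := by
    rw [hTval, ← hx]; field_simp
  have hxa : 24 * a * L ≤ x := by
    have := mul_le_mul_of_nonneg_left hγge hη.le
    rw [hx, ha]; linarith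
  have haT : 12 * (a * T) ≤ 1 := by
    have : 12 * (a * T) * x ≤ 1 * x := by nlinarith
    exact le_of_mul_le_mul_right this hx0
  have hax : 12 * a ≤ x := by nlinarith
  have hηΔ : η * Δ ≤ a * μ := by
    have := mul_le_mul_of_nonneg_left hΔle hη.le
    rw [ha]; linarith
  simp only [← hx] at hηγ hψrec hφrec ⊢
  have hx1 : x ≤ 1 := hηγ
  have hrec : ∀ t, ψ (t + 1) ≥ (1 + x) * ψ t
      - 2 * a * Real.sqrt (ψ t ^ 2 + φ t ^ 2) - 2 * (η * Δ) := by
    intro t; have := hψrec t; rw [ha]; linarith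
  have hrec' : ∀ t, φ (t + 1) ≤ (1 + x) * φ t
      + 2 * a * Real.sqrt (ψ t ^ 2 + φ t ^ 2) + 2 * (η * Δ) := by
    intro t; have := hφrec t; rw [ha]; linarith
  -- one step
  have step : ∀ t, t + 1 ≤ T → μ ≤ ψ t → φ t ≤ (t / T : ℝ) * ψ t →
      ψ (t + 1) ≥ (1 + x / 2) * ψ t ∧ φ (t + 1) ≤ ((t + 1 : ℕ) / T : ℝ) * ψ (t + 1) := by
    intro t ht hm hp
    have htT : (t : ℝ) + 1 ≤ T := by exact_mod_cast ht
    have hψp : 0 < ψ t := by linarith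
    have hd1 : (t / T : ℝ) ≤ 1 := by rw [div_le_one hT0]; linarith
    have hφψ : φ t ≤ ψ t := by nlinarith
    have hsq : Real.sqrt (ψ t ^ 2 + φ t ^ 2) ≤ 3 / 2 * ψ t := by
      apply Real.sqrt_le_iff.mpr
      constructor
      · linarith
      · nlinarith [hφnn t]
    have hE : 2 * a * Real.sqrt (ψ t ^ 2 + φ t ^ 2) + 2 * (η * Δ) ≤ 5 * a * ψ t := by
      have h1 := mul_le_mul_of_nonneg_left hsq ha0.le
      have h2 := mul_le_mul_of_nonneg_left hm ha0.le
      linarith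
    have h1 : ψ (t + 1) ≥ (1 + x - 5 * a) * ψ t := by linarith [hrec t]
    have h2 : φ (t + 1) ≤ ((1 + x) * (t / T) + 5 * a) * ψ t := by
      have := mul_le_mul_of_nonneg_left hp (by linarith : 0 ≤ 1 + x)
      linarith [hrec' t]
    refine ⟨?_, ?_⟩
    · have : (1 + x / 2) * ψ t ≤ (1 + x - 5 * a) * ψ t :=
        mul_le_mul_of_nonneg_right (by linarith) hψp.le
      linarith
    · have h3 : (1 + x) * (t / T) + 5 * a ≤ ((t + 1 : ℕ) / T : ℝ) * (1 + x - 5 * a) := by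
        have e1 : (1 + x) * (t / T) + 5 * a = ((1 + x) * t + 5 * (a * T)) / T := by
          field_simp
        have e2 : ((t + 1 : ℕ) / T : ℝ) * (1 + x - 5 * a)
            = (((t : ℝ) + 1) * (1 + x - 5 * a)) / T := by
          push_cast; field_simp
        rw [e1, e2]
        apply div_le_div_of_nonneg_right _ hT0.le
        have := mul_le_mul_of_nonneg_left htT ha0.le
        linarith
      have h4 := mul_le_mul_of_nonneg_right h3 hψp.le
      have h5 : (0 : ℝ) ≤ ((t + 1 : ℕ) / T : ℝ) := by positivity
      have h6 := mul_le_mul_of_nonneg_left h1 h5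
      linarith
  have main : ∀ t, t ≤ T → (1 + x / 2) ^ t * ψ 0 ≤ ψ t ∧ μ ≤ ψ t ∧ φ t ≤ (t / T : ℝ) * ψ t := by
    intro t
    induction t with
    | zero => intro _; simp [hφ0]; exact hψ0
    | succ t ih =>
      intro ht
      obtain ⟨h1, h2, h3⟩ := ih (by omega)
      obtain ⟨h4, h5⟩ := step t ht h2 h3
      refine ⟨?_, ?_, h5⟩
      · have := mul_le_mul_of_nonneg_left h1 (by linarith : 0 ≤ 1 + x / 2)
        rw [pow_succ]; linarith
      · nlinarith
  refine ⟨?_, fun t ht => (main t ht).2.2, (main T le_rfl).1, ?_⟩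
  · intro t h1 ht
    obtain ⟨s, rfl⟩ : ∃ s, t = s + 1 := ⟨t - 1, by omega⟩
    have hm := main s (by omega)
    simpa using (step s ht hm.2.1 hm.2.2).1
  · have hb := rpow_one_add_le_one_add_mul_self (s := (1 / 2 : ℝ)) (p := x)
      (by norm_num) hx0.le hx1
    have hp : (((1 + 1 / 2 : ℝ)) ^ x) ^ T ≤ (1 + x / 2) ^ T := by
      apply pow_le_pow_left₀ (by positivity)
      linarith
    have he : (((1 + 1 / 2 : ℝ)) ^ x) ^ T = 2 * (R + r) / μ := by
      rw [← Real.rpow_natCast, ← Real.rpow_mul (by norm_num), mul_comm x, hTx,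
        Real.rpow_mul (by norm_num)]
      have : ((1 + 1 / 2 : ℝ)) ^ (2 : ℝ) = 9 / 4 := by norm_num
      rw [this, hL]
      exact Real.rpow_logb (by norm_num) (by norm_num) (by linarith)
    rw [he] at hp
    have h1 := mul_le_mul hp hψ0 hμ.le (by positivity)
    rw [div_mul_cancel₀ _ hμ.ne'] at h1
    exact h1
end

section
/- Let F : ℝ^d → ℝ be L-smooth and ρ-Hessian-Lipschitz, let w̃ ∈ ℝ^d, and suppose there is a unit vector e ∈ ℝ^d and a real number λ ≤ −γ < 0 with ∇²F(w̃)·e = λ·e. Let μ ∈ (0, r), let u_0, y_0 lie in the closed Euclidean ball B(w̃, r) with y_0 = u_0 + μ_0·e for some μ_0 ≥ μ, and set η = 1/L. Suppose the parameters satisfy T_th = (2/(ηγ))·log_{9/4}(2(R+r)/μ) (a positive integer), R ≥ μ, ρ(R+r)μ ≥ Δ, and γ ≥ 24·ρ(R+r)·log_{9/4}(2(R+r)/μ). Then for any two Δ-inexact gradient descent sequences u_0, …, u_{T_th} and y_0, …, y_{T_th} for F with step size η, it cannot hold that ‖u_t − u_0‖ < R and ‖y_t − y_0‖ < R for all t ≤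 T_th. -/
theorem stuck_split {d : ℕ} (A : EuclideanSpace ℝ (Fin d) →L[ℝ] EuclideanSpace ℝ (Fin d))
    (hA : (A : EuclideanSpace ℝ (Fin d) →ₗ[ℝ] EuclideanSpace ℝ (Fin d)).IsSymmetric)
    (L γ : ℝ) (hL : 0 < L) (hγ : 0 < γ) (hAL : ‖A‖ ≤ L) :
    ∃ P : EuclideanSpace ℝ (Fin d) → EuclideanSpace ℝ (Fin d),
      (∀ x y, P (x + y) = P x + P y) ∧ (∀ x, ‖P x‖ ≤ ‖x‖) ∧ (∀ x, ‖x - P x‖ ≤ ‖x‖) ∧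
      (∀ x (lam : ℝ), lam ≤ -γ → A x = lam • x → P x = x) ∧
      (∀ x, (1 + 1 / L * γ) * ‖P x‖ ≤ ‖P (x - (1 / L) • A x)‖) ∧
      (∀ x, ‖(x - (1 / L) • A x) - P (x - (1 / L) • A x)‖ ≤ (1 + 1 / L * γ) * ‖x - P x‖) := by
  classical
  have hn : Module.finrank ℝ (EuclideanSpace ℝ (Fin d)) = d := by simp
  set b := hA.eigenvectorBasis hn with hb
  set ev := hA.eigenvalues hn with hev
  have hAb : ∀ x i, b.repr (A x) i = ev i * b.repr x i := by
    intro x i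
    exact hA.eigenvectorBasis_apply_self_apply hn x i
  have hevL : ∀ i, |ev i| ≤ L := by
    intro i
    have h1 : A (b i) = ev i • b i := hA.apply_eigenvectorBasis hn i
    have h2 := A.le_opNorm (b i)
    rw [h1, norm_smul, b.norm_eq_one, mul_one, mul_one] at h2
    exact h2.trans hAL
  set η := 1 / L with hη
  have hη0 : 0 < η := by positivity
  have hηL : η * L = 1 := by rw [hη]; field_simp
  let P : EuclideanSpace ℝ (Fin d) → EuclideanSpace ℝ (Fin d) := fun x =>
    b.repr.symm (WithLp.toLp 2 fun i => if ev i ≤ -γ then b.repr x i else 0)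
  have hP : ∀ x i, b.repr (P x) i = if ev i ≤ -γ then b.repr x i else 0 := by
    intro x i
    simp [P]
  have hle : ∀ (x y : EuclideanSpace ℝ (Fin d)) (c : ℝ), 0 ≤ c →
      (∀ i, |b.repr x i| ≤ c * |b.repr y i|) → ‖x‖ ≤ c * ‖y‖ := by
    intro x y c hc h
    rw [← b.repr.norm_map x, ← b.repr.norm_map y]
    refine abs_le_of_sq_le_sq' ?_ (by positivity) |>.2
    rw [mul_pow, EuclideanSpace.norm_sq_eq, EuclideanSpace.norm_sq_eq, Finset.mul_sum]
    refine Finset.sum_le_sum fun i _ => ?_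
    rw [← mul_pow, Real.norm_eq_abs, Real.norm_eq_abs]
    exact pow_le_pow_left₀ (abs_nonneg _) (h i) 2
  have hext : ∀ x y : EuclideanSpace ℝ (Fin d), (∀ i, b.repr x i = b.repr y i) → x = y := by
    intro x y h
    apply b.repr.injective
    ext i
    exact h i
  have hstep : ∀ x i, b.repr (x - η • A x) i = (1 - η * ev i) * b.repr x i := by
    intro x i
    simp [hAb]
    ring
  have hsub : ∀ x i, b.repr (x - P x) i = if ev i ≤ -γ then 0 else b.repr x i := by
    intro x i
    have : b.repr (x - P x) i = b.repr x i - b.repr (P x) i := by simp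
    rw [this, hP]
    split_ifs <;> simp
  refine ⟨P, ?_, ?_, ?_, ?_, ?_, ?_⟩
  · intro x y
    apply hext
    intro i
    have : b.repr (P x + P y) i = b.repr (P x) i + b.repr (P y) i := by simp
    rw [this, hP, hP, hP]
    split_ifs <;> simp
  · intro x
    rw [← one_mul ‖x‖]
    apply hle _ _ _ zero_le_one
    intro i
    rw [hP]
    split_ifs <;> simp
  · intro x
    rw [← one_mul ‖x‖]
    apply hle _ _ _ zero_le_one
    intro i
    rw [hsub]
    split_ifs <;> simp
  · intro x lam hlam hx
    apply hext
    intro i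
    rw [hP]
    split_ifs with h
    · rfl
    · have h1 := hAb x i
      rw [hx] at h1
      have h2 : lam * b.repr x i = ev i * b.repr x i := by simpa using h1
      have h3 : (lam - ev i) * b.repr x i = 0 := by linarith
      rcases mul_eq_zero.1 h3 with h4 | h4
      · exfalso; apply h; linarith
      · exact h4.symm
  · intro x
    have hc : 0 < 1 + η * γ := by positivity
    have : ‖P x‖ ≤ (1 + η * γ)⁻¹ * ‖P (x - η • A x)‖ := by
      apply hle _ _ _ (by positivity)
      intro i
      rw [hP, hP, hstep]
      split_ifs with h
      · rw [abs_mul, ← mul_assoc, inv_mul_eq_div]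
        have h1 : 1 + η * γ ≤ |1 - η * ev i| := by
          refine le_trans ?_ (le_abs_self _)
          nlinarith
        have h2 : 1 ≤ |1 - η * ev i| / (1 + η * γ) := by
          rw [le_div_iff₀ hc]; linarith
        nlinarith [abs_nonneg (b.repr x i)]
      · simp
    rw [inv_mul_eq_div, le_div_iff₀ hc] at this
    linarith
  · intro x
    have hc : 0 < 1 + η * γ := by positivity
    apply hle _ _ _ hc.le
    intro i
    rw [hsub, hsub, hstep]
    split_ifs with h
    · simp
    · rw [abs_mul]
      refine mul_le_mul_of_nonneg_right ?_ (abs_nonneg _)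
      have := abs_le.1 (hevL i)
      push Not at h
      rw [abs_le]
      constructor <;> nlinarith

theorem stuck_hess {d : ℕ} (F : EuclideanSpace ℝ (Fin d) → ℝ) (hF : ContDiff ℝ 2 F) :
    Differentiable ℝ (gradient F) ∧
    ∀ w, (fderiv ℝ (gradient F) w :
      EuclideanSpace ℝ (Fin d) →ₗ[ℝ] EuclideanSpace ℝ (Fin d)).IsSymmetric := by
  have hd : Differentiable ℝ (fderiv ℝ F) :=
    (hF.fderiv_right (m := 1) (by norm_num)).differentiable (by norm_num)
  let T : StrongDual ℝ (EuclideanSpace ℝ (Fin d)) ≃ₗᵢ[ℝ] EuclideanSpace ℝ (Fin d) :=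
    (InnerProductSpace.toDual ℝ (EuclideanSpace ℝ (Fin d))).symm
  have hg : ∀ w, HasFDerivAt (gradient F)
      ((T.toContinuousLinearEquiv : _ →L[ℝ] EuclideanSpace ℝ (Fin d)).comp
        (fderiv ℝ (fderiv ℝ F) w)) w := by
    intro w
    exact (T.toContinuousLinearEquiv :
      _ →L[ℝ] EuclideanSpace ℝ (Fin d)).hasFDerivAt.comp w (hd w).hasFDerivAt
  refine ⟨fun w => (hg w).differentiableAt, fun w x y => ?_⟩
  have hs : IsSymmSndFDerivAt ℝ F w := hF.contDiffAt.isSymmSndFDerivAt (by simp)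
  rw [(hg w).fderiv]
  have h1 : ∀ a c, inner ℝ (T (fderiv ℝ (fderiv ℝ F) w a)) c = fderiv ℝ (fderiv ℝ F) w a c := by
    intro a c
    exact InnerProductSpace.toDual_symm_apply
  change inner ℝ (T (fderiv ℝ (fderiv ℝ F) w x)) y = inner ℝ x (T (fderiv ℝ (fderiv ℝ F) w y))
  rw [real_inner_comm _ x, h1, h1]
  exact hs x y

set_option maxHeartbeats 2000000 in
/-- (Lemma "moving distance"). Near a saddle point `w̃` whose Hessian has an
eigenvalue `λ ≤ -γ < 0` with unit eigenvector `e`, two `Δ`-inexact gradient descent sequences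
started at points `u₀, y₀ ∈ B(w̃, r)` differing by `μ₀ ≥ μ` along `e` cannot both stay within
distance `R` of their starting points for all `t ≤ T_th`. -/
theorem cannot_both_be_stuck
    (d : ℕ) (F : EuclideanSpace ℝ (Fin d) → ℝ) (L ρ : ℝ)
    (hL : 0 < L) (hρ : 0 < ρ)
    (hF : ContDiff ℝ 2 F)
    (hsmooth : ∀ x y : EuclideanSpace ℝ (Fin d),
      ‖gradient F x - gradient F y‖ ≤ L * ‖x - y‖)
    (hhess : ∀ x y : EuclideanSpace ℝ (Fin d),
      ‖fderiv ℝ (gradient F) x - fderiv ℝ (gradient F) y‖ ≤ ρ * ‖x - y‖)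
    (wt : EuclideanSpace ℝ (Fin d)) (e : EuclideanSpace ℝ (Fin d)) (lam γ : ℝ)
    (he : ‖e‖ = 1) (heig : fderiv ℝ (gradient F) wt e = lam • e)
    (hγ : 0 < γ) (hlam : lam ≤ -γ)
    (R r μ μ₀ Δ : ℝ) (hR : 0 < R) (hr : 0 < r) (hμ : 0 < μ) (hμr : μ < r) (hΔ : 0 ≤ Δ)
    (u₀ y₀ : EuclideanSpace ℝ (Fin d))
    (hu₀ : u₀ ∈ Metric.closedBall wt r) (hy₀ : y₀ ∈ Metric.closedBall wt r)
    (hy₀u₀ : y₀ = u₀ + μ₀ • e) (hμ₀ : μ₀ ≥ μ)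
    (Tth : ℕ) (hTth : 0 < Tth)
    (hTval : (Tth : ℝ) = 2 / ((1 / L) * γ) * Real.logb (9 / 4) (2 * (R + r) / μ))
    (hRμ : R ≥ μ) (hΔle : ρ * (R + r) * μ ≥ Δ)
    (hγge : γ ≥ 24 * ρ * (R + r) * Real.logb (9 / 4) (2 * (R + r) / μ))
    (u y gu gy : ℕ → EuclideanSpace ℝ (Fin d))
    (hu0 : u 0 = u₀) (hy0 : y 0 = y₀)
    (huseq : ∀ τ < Tth, ‖gu τ - gradient F (u τ)‖ ≤ Δ ∧
      u (τ + 1) = u τ - (1 / L) • gu τ)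
    (hyseq : ∀ τ < Tth, ‖gy τ - gradient F (y τ)‖ ≤ Δ ∧
      y (τ + 1) = y τ - (1 / L) • gy τ) :
    ¬ (∀ t ≤ Tth, ‖u t - u 0‖ < R ∧ ‖y t - y 0‖ < R) := by
  intro hall
  obtain ⟨hdiff, hsymm⟩ := stuck_hess F hF
  have hHL : ∀ w, ‖fderiv ℝ (gradient F) w‖ ≤ L := by
    intro w
    have hlip : LipschitzWith ⟨L, hL.le⟩ (gradient F) :=
      LipschitzWith.of_dist_le_mul fun a c => by
        rw [dist_eq_norm, dist_eq_norm]; exact hsmooth a c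
    exact norm_fderiv_le_of_lipschitz ℝ hlip
  set A := fderiv ℝ (gradient F) wt with hA
  obtain ⟨P, hadd, hPle, hQle, hPe, hPs, hQs⟩ := stuck_split A (hsymm wt) L γ hL hγ (hHL wt)
  have hγL : γ ≤ L := by
    have h2 := A.le_opNorm e
    rw [heig, norm_smul, he, mul_one, mul_one, Real.norm_eq_abs] at h2
    have h3 := hHL wt
    have h4 := neg_le_abs lam
    linarith
  set X := 2 * (R + r) / μ with hX
  set ℓ := Real.logb (9 / 4) X with hℓ
  have hX4 : 4 ≤ X := by
    rw [hX, le_div_iff₀ hμ]; linarith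
  have hℓ1 : 1 ≤ ℓ := by
    rw [hℓ, Real.le_logb_iff_rpow_le (by norm_num) (by linarith), Real.rpow_one]; linarith
  set η := 1 / L with hη
  have hη0 : 0 < η := by positivity
  have hηL : η * L = 1 := by rw [hη]; field_simp
  set K := ρ * (R + r) with hK
  have hK0 : 0 < K := by positivity
  set ε := η * K with hε
  have hε0 : 0 < ε := by positivity
  set x := η * γ with hx
  have hx0 : 0 < x := by positivity
  have hx1 : x ≤ 1 := by rw [← hηL, hx]; gcongr
  have hγK : 24 * (K * ℓ) ≤ γ := by rw [hK]; linarith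
  have hTx : (Tth : ℝ) * x = 2 * ℓ := by rw [hTval]; field_simp
  have hεl : 24 * (ε * ℓ) ≤ x := by
    have := mul_le_mul_of_nonneg_left hγK hη0.le
    rw [hε, hx]; linarith
  have hεx : 24 * ε ≤ x := by nlinarith
  have hTε : 12 * (ε * Tth) ≤ 1 := by
    have h1 : 24 * (ε * ℓ) * Tth ≤ x * Tth := by gcongr
    have h2 : (12 * (ε * Tth)) * (2 * ℓ) ≤ 1 * (2 * ℓ) := by linarith
    exact le_of_mul_le_mul_right h2 (by linarith)
  -- the one-step error bound
  have hmem : ∀ t ≤ Tth, u t ∈ Metric.closedBall wt (R + r) ∧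
      y t ∈ Metric.closedBall wt (R + r) := by
    intro t ht
    have h := hall t ht
    rw [← hu0] at hu₀
    rw [← hy0] at hy₀
    rw [Metric.mem_closedBall] at hu₀ hy₀ ⊢
    rw [Metric.mem_closedBall]
    rw [← dist_eq_norm, ← dist_eq_norm] at h
    have h1 := dist_triangle (u t) (u 0) wt
    have h2 := dist_triangle (y t) (y 0) wt
    constructor <;> linarith [h.1, h.2]
  have hgrad : ∀ t ≤ Tth, ‖gradient F (y t) - gradient F (u t) - A (y t - u t)‖
      ≤ K * ‖y t - u t‖ := by
    intro t ht
    refine (convex_closedBall wt (R + r)).norm_image_sub_le_of_norm_hasFDerivWithin_le'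
      (f' := fderiv ℝ (gradient F)) (fun z _ => (hdiff z).hasFDerivAt.hasFDerivWithinAt)
      (fun z hz => ?_) (hmem t ht).1 (hmem t ht).2
    refine (hhess z wt).trans ?_
    rw [Metric.mem_closedBall, dist_eq_norm] at hz
    rw [hK]; gcongr
  have hδ : ∀ t < Tth, ∃ δ, y (t + 1) - u (t + 1) =
      ((y t - u t) - η • A (y t - u t)) + δ ∧ ‖δ‖ ≤ ε * ‖y t - u t‖ + 2 * (ε * μ) := by
    intro t ht
    obtain ⟨h1, h2⟩ := huseq t ht
    obtain ⟨h3, h4⟩ := hyseq t ht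
    have h5 := hgrad t ht.le
    refine ⟨-(η • ((gradient F (y t) - gradient F (u t) - A (y t - u t))
      + (gy t - gradient F (y t)) - (gu t - gradient F (u t)))), ?_, ?_⟩
    · rw [h2, h4]; module
    · rw [norm_neg, norm_smul, Real.norm_eq_abs, abs_of_pos hη0]
      have h6 := norm_sub_le ((gradient F (y t) - gradient F (u t) - A (y t - u t))
        + (gy t - gradient F (y t))) (gu t - gradient F (u t))
      have h7 := norm_add_le (gradient F (y t) - gradient F (u t) - A (y t - u t))
        (gy t - gradient F (y t))
      have h8 : ‖(gradient F (y t) - gradient F (u t) - A (y t - u t))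
        + (gy t - gradient F (y t)) - (gu t - gradient F (u t))‖
          ≤ K * ‖y t - u t‖ + 2 * (K * μ) := by linarith
      have := mul_le_mul_of_nonneg_left h8 hη0.le
      rw [hε]; linarith
  have hind : ∀ t ≤ Tth, (1 + x - 4 * ε) ^ t * μ ≤ ‖P (y t - u t)‖ ∧
      ‖(y t - u t) - P (y t - u t)‖ ≤ 8 * ε * t * ‖P (y t - u t)‖ := by
    intro t
    induction t with
    | zero =>
      intro _
      have h0 : y 0 - u 0 = μ₀ • e := by rw [hy0, hu0, hy₀u₀]; abel
      have h1 : P (y 0 - u 0) = y 0 - u 0 := by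
        apply hPe _ lam hlam
        rw [h0, map_smul, heig, smul_comm]
      rw [h1, h0, norm_smul, he, Real.norm_eq_abs, abs_of_pos (by linarith)]
      simp
      exact hμ₀
    | succ t ih =>
      intro ht
      obtain ⟨ih1, ih2⟩ := ih (by omega)
      obtain ⟨δ, hv, hδn⟩ := hδ t (by omega)
      set v := y t - u t with hvdef
      have hsu := hPs v
      have hsq := hQs v
      set s := v - η • A v with hs
      rw [hv, hadd]
      have htT : ((t : ℝ) + 1) ≤ Tth := by exact_mod_cast ht
      have hεt : 12 * (ε * (t + 1)) ≤ 1 := by nlinarith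
      have hbase : 1 ≤ 1 + x - 4 * ε := by linarith
      have hμp : μ ≤ ‖P v‖ := by
        refine le_trans ?_ ih1
        have := one_le_pow₀ hbase (n := t)
        nlinarith
      have hp0 : 0 < ‖P v‖ := by linarith
      have hqp : ‖v - P v‖ ≤ ‖P v‖ := by
        refine ih2.trans ?_
        have : 8 * ε * t ≤ 1 := by nlinarith
        nlinarith
      have hvn : ‖v‖ ≤ 2 * ‖P v‖ := by
        have h := norm_add_le (P v) (v - P v)
        rw [add_sub_cancel] at h
        linarith
      have hδ4 : ‖δ‖ ≤ 4 * ε * ‖P v‖ := by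
        have h1 := mul_le_mul_of_nonneg_left hvn hε0.le
        have h2 := mul_le_mul_of_nonneg_left hμp hε0.le
        linarith
      have hp' : (1 + x - 4 * ε) * ‖P v‖ ≤ ‖P s + P δ‖ := by
        have h1 := norm_sub_le (P s + P δ) (P δ)
        rw [add_sub_cancel_right] at h1
        have h2 := hPle δ
        linarith
      have hq' : ‖s + δ - (P s + P δ)‖ ≤ (1 + x) * ‖v - P v‖ + 4 * ε * ‖P v‖ := by
        have h1 := norm_add_le (s - P s) (δ - P δ)
        have h2 := hQle δ
        have h3 : s + δ - (P s + P δ) = (s - P s) + (δ - P δ) := by abel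
        rw [h3]
        linarith
      constructor
      · rw [pow_succ]
        refine le_trans ?_ hp'
        have := mul_le_mul_of_nonneg_left ih1 (by linarith : 0 ≤ 1 + x - 4 * ε)
        linarith
      · push_cast
        have h1 := mul_le_mul_of_nonneg_left ih2 (by linarith : 0 ≤ 1 + x)
        have h2 : 0 ≤ 8 * ε * ((t : ℝ) + 1) := by positivity
        have h3 := mul_le_mul_of_nonneg_left hp' h2
        have h4 : (1 + x) * (8 * ε * t) + 4 * ε ≤ 8 * ε * (t + 1) * (1 + x - 4 * ε) := by
          have h5 : 0 ≤ 4 * ε * (1 + 2 * x - 8 * (ε * (t + 1))) := by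
            apply mul_nonneg (by linarith)
            linarith
          linarith
        have h6 := mul_le_mul_of_nonneg_right h4 hp0.le
        linarith
  have hfin := (hind Tth le_rfl).1
  have hup : ‖P (y Tth - u Tth)‖ < 2 * (R + r) := by
    refine (hPle _).trans_lt ?_
    have h := hall Tth le_rfl
    rw [← hu0] at hu₀
    rw [← hy0] at hy₀
    rw [Metric.mem_closedBall] at hu₀ hy₀
    rw [← dist_eq_norm, ← dist_eq_norm] at h
    rw [← dist_eq_norm]
    have h1 := dist_triangle (y Tth) (y 0) (u Tth)
    have h2 := dist_triangle (y 0) wt (u Tth)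
    have h3 := dist_triangle wt (u 0) (u Tth)
    rw [dist_comm wt (u 0), dist_comm (u 0) (u Tth)] at h3
    linarith [h.1, h.2]
  have hlow : X ≤ (1 + x - 4 * ε) ^ Tth := by
    have hb : ((9 : ℝ) / 4) ^ (x / 2) ≤ 1 + x - 4 * ε := by
      have h1 : ((9 : ℝ) / 4) ^ (x / 2) = (1 + 1 / 2 : ℝ) ^ x := by
        rw [show ((9 : ℝ) / 4) = (1 + 1 / 2 : ℝ) ^ (2 : ℝ) by norm_num,
          ← Real.rpow_mul (by norm_num)]
        congr 1
        ring
      rw [h1]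
      have h2 := rpow_one_add_le_one_add_mul_self (s := (1 / 2 : ℝ)) (by norm_num) hx0.le hx1
      linarith
    have h2 : X = (((9 : ℝ) / 4) ^ (x / 2)) ^ Tth := by
      rw [← Real.rpow_natCast, ← Real.rpow_mul (by norm_num)]
      have : x / 2 * (Tth : ℝ) = ℓ := by linarith
      rw [this, hℓ, Real.rpow_logb (by norm_num) (by norm_num) (by linarith)]
    rw [h2]
    exact pow_le_pow_left₀ (by positivity) hb _
  have hXμ : X * μ = 2 * (R + r) := by rw [hX]; field_simp
  have := mul_le_mul_of_nonneg_right hlow hμ.le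
  linarith
end

section
/- Let F : ℝ^d → ℝ be L-smooth and ρ-Hessian-Lipschitz with λ_min(∇²F(w̃)) ≤ −γ < 0 at a point w̃ ∈ ℝ^d, let η = 1/L, μ ∈ (0, r), and suppose T_th = (2/(ηγ))·log_{9/4}(2(R+r)/μ) (a positive integer), R ≥ μ, ρ(R+r)μ ≥ Δ, and γ ≥ 24·ρ(R+r)·log_{9/4}(2(R+r)/μ). Define the stuck region W_S ⊆ B(w̃, r) as the set of w_0 in the closed ball B(w̃, r) for which there exists a Δ-inexact gradient descent sequence w_0, w_1, …, w_{T_th} for F with step size η satisfying ‖w_t − w_0‖ < R for all t ≤ T_th. Then the Lebesgue measure of W_S is at most (2μ√d/r) times the Lebesgue measure of B(w̃, r); equivalently, a point w_0 drawn uniformly at random from B(w̃, r) lies in W_S with probability at most 2μ√d/r. -/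
open MeasureTheory

lemma ball_ratio (n : ℕ) (r : ℝ) (hr : 0 < r) (c : EuclideanSpace ℝ (Fin (n+1))) :
    volume (Metric.closedBall (0 : EuclideanSpace ℝ (Fin n)) r) ≤
      ENNReal.ofReal (2 * Real.sqrt ((n + 1 : ℕ) : ℝ) / r) * volume (Metric.closedBall c r) := by
  have key : volume (Metric.closedBall (0 : EuclideanSpace ℝ (Fin n)) r) ≤ 
     ENNReal.ofReal (r ^ n * (Real.sqrt Real.pi ^ n / Real.Gamma (n / 2 + 1))) := by
    rcases Nat.eq_zero_or_pos n with h | h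
    · subst h
      calc _ ≤ volume (Set.univ : Set (EuclideanSpace ℝ (Fin 0))) := measure_mono (Set.subset_univ _)
        _ = 1 := by
          rw [← (EuclideanSpace.volume_preserving_symm_measurableEquiv_toLp (Fin 0)).symm.measure_preimage_equiv]
          simp [volume_pi]
        _ ≤ _ := by simp
    · have : Nonempty (Fin n) := ⟨⟨0, h⟩⟩
      rw [EuclideanSpace.volume_closedBall, Fintype.card_fin, ENNReal.ofReal_mul (by positivity), ENNReal.ofReal_pow hr.le]
  refine key.trans ?_
  rw [EuclideanSpace.volume_closedBall, Fintype.card_fin, ← ENNReal.ofReal_pow hr.le,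
    ← ENNReal.ofReal_mul (by positivity), ← ENNReal.ofReal_mul (by positivity)]
  apply ENNReal.ofReal_le_ofReal
  have hx : (0:ℝ) < n / 2 + 1 := by positivity
  have hG := Real.Gamma_mul_add_mul_le_rpow_Gamma_mul_rpow_Gamma (s := n/2+1) (t := n/2+1+1) (a := 1/2) (b := 1/2)
    hx (by positivity) (by norm_num) (by norm_num) (by norm_num)
  rw [Real.Gamma_add_one hx.ne', Real.mul_rpow hx.le (Real.Gamma_pos_of_pos hx).le, mul_left_comm,
    ← Real.rpow_add (Real.Gamma_pos_of_pos hx)] at hG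
  norm_num at hG
  rw [← Real.sqrt_eq_rpow] at hG
  have e1 : (1/2 * ((n:ℝ)/2+1) + 1/2 * (n/2+1+1)) = ((n+1:ℕ):ℝ)/2+1 := by push_cast; ring
  rw [e1] at hG
  set G := Real.Gamma (n/2+1) with hGd
  set G' := Real.Gamma (((n+1:ℕ):ℝ)/2+1) with hGd'
  have hGp : 0 < G := Real.Gamma_pos_of_pos hx
  have hGp' : 0 < G' := Real.Gamma_pos_of_pos (by positivity)
  have hs : Real.sqrt ((n:ℝ)/2+1) ≤ Real.sqrt ((n+1:ℕ):ℝ) * 2 * Real.sqrt Real.pi := by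
    have h1 : Real.sqrt ((n:ℝ)/2+1) ≤ Real.sqrt ((n+1:ℕ):ℝ) := by
      apply Real.sqrt_le_sqrt; push_cast; linarith [Nat.cast_nonneg (α := ℝ) n]
    have h2 : 1 ≤ Real.sqrt Real.pi := by
      rw [Real.one_le_sqrt]; linarith [Real.pi_gt_three]
    nlinarith [Real.sqrt_nonneg ((n+1:ℕ):ℝ)]
  have hle : G' ≤ Real.sqrt ((n+1:ℕ):ℝ) * 2 * Real.sqrt Real.pi * G := hG.trans (by gcongr)
  calc r ^ n * (√Real.pi ^ n / G) = r^n * √Real.pi^n * (1 / G) := by ring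
    _ ≤ r^n * √Real.pi^n * ((Real.sqrt ((n+1:ℕ):ℝ) * 2 * Real.sqrt Real.pi) / G') := by
      apply mul_le_mul_of_nonneg_left _ (by positivity)
      rw [div_le_div_iff₀ hGp hGp']; linarith
    _ = _ := by rw [pow_succ, pow_succ]; field_simp

lemma slab_bound (n : ℕ) (K : Set (EuclideanSpace ℝ (Fin (n+1)))) (hK : MeasurableSet K) (i : Fin (n+1))
    (c : EuclideanSpace ℝ (Fin (n+1))) (r μ : ℝ)
    (hsub : K ⊆ Metric.closedBall c r)
    (hgap : ∀ x ∈ K, ∀ y ∈ K, (∀ j, j ≠ i → x j = y j) → |x i - y i| ≤ μ) :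
    volume K ≤ ENNReal.ofReal μ * volume (Metric.closedBall (0 : EuclideanSpace ℝ (Fin n)) r) := by
  set e1 := (MeasurableEquiv.piFinSuccAbove (fun _ : Fin (n+1) => ℝ) i).symm
  have he1 : ∀ p, e1 p = i.insertNth p.1 p.2 := fun _ => rfl
  set e2 := MeasurableEquiv.toLp 2 (Fin (n+1) → ℝ)
  have m1 : MeasurePreserving e1 volume volume := (volume_preserving_piFinSuccAbove (fun _ : Fin (n+1) => ℝ) i).symm
  have m2 : MeasurePreserving e2 volume volume := (EuclideanSpace.volume_preserving_symm_measurableEquiv_toLp (Fin (n+1))).symm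
  set S := e1 ⁻¹' (e2 ⁻¹' K)
  have hS : MeasurableSet S := e1.measurable (e2.measurable hK)
  have hv : volume K = volume S := by
    rw [m1.measure_preimage_equiv, m2.measure_preimage_equiv]
  have m3 : MeasurePreserving (MeasurableEquiv.toLp 2 (Fin n → ℝ)) volume volume := 
    (EuclideanSpace.volume_preserving_symm_measurableEquiv_toLp (Fin n)).symm
  set c' : EuclideanSpace ℝ (Fin n) := WithLp.toLp 2 (fun j => c (i.succAbove j))
  set D := (MeasurableEquiv.toLp 2 (Fin n → ℝ)) ⁻¹' (Metric.closedBall c' r)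
  have hD : MeasurableSet D := (MeasurableEquiv.toLp 2 (Fin n → ℝ)).measurable Metric.isClosed_closedBall.measurableSet
  have hDv : volume D = volume (Metric.closedBall (0 : EuclideanSpace ℝ (Fin n)) r) := by
    rw [m3.measure_preimage_equiv, Measure.addHaar_closedBall_center]
  rw [hv, Measure.volume_eq_prod, Measure.prod_apply_symm hS, ← hDv, ← lintegral_indicator_const hD]
  apply lintegral_mono
  intro y
  dsimp only
  by_cases hy : y ∈ D
  · rw [Set.indicator_of_mem hy]
    refine (Real.volume_le_diam _).trans ?_
    apply Metric.ediam_le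
    intro s hs t ht
    rw [edist_dist, Real.dist_eq]
    apply ENNReal.ofReal_le_ofReal
    have := hgap _ hs _ ht (by
      intro j hj
      obtain ⟨k, rfl⟩ := Fin.exists_succAbove_eq hj
      simp [he1, e2])
    simpa [he1, e2] using this
  · rw [Set.indicator_of_notMem hy]
    have : (fun x => (x, y)) ⁻¹' S = ∅ := by
      rw [Set.eq_empty_iff_forall_notMem]
      intro s hs
      apply hy
      have h := hsub hs
      simp only [D, Set.mem_preimage, mem_closedBall_iff_norm] at h ⊢
      rw [EuclideanSpace.norm_eq] at h ⊢
      refine le_trans (Real.sqrt_le_sqrt ?_) h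
      rw [Fin.sum_univ_succAbove _ i]
      simp [he1, e2, c']
      try positivity
    rw [this]; simp

lemma hess_symm {d : ℕ} (F : EuclideanSpace ℝ (Fin d) → ℝ) (hF : ContDiff ℝ 2 F)
    (x : EuclideanSpace ℝ (Fin d)) :
    Differentiable ℝ (gradient F) ∧ (fderiv ℝ (gradient F) x : EuclideanSpace ℝ (Fin d) →ₗ[ℝ] EuclideanSpace ℝ (Fin d)).IsSymmetric := by
  have hd : Differentiable ℝ (fderiv ℝ F) :=
    (hF.fderiv_right (m := 1) (by norm_num)).differentiable (by norm_num)
  let φ : (EuclideanSpace ℝ (Fin d) →L[ℝ] ℝ) →L[ℝ] EuclideanSpace ℝ (Fin d) :=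
    { toFun := fun f => (InnerProductSpace.toDual ℝ (EuclideanSpace ℝ (Fin d))).symm f
      map_add' := fun f g => map_add _ f g
      map_smul' := fun c f => by simp
      cont := (InnerProductSpace.toDual ℝ (EuclideanSpace ℝ (Fin d))).symm.continuous }
  have hg : ∀ y, HasFDerivAt (gradient F) (φ.comp (fderiv ℝ (fderiv ℝ F) y)) y := by
    intro y
    exact φ.hasFDerivAt.comp y (hd y).hasFDerivAt
  refine ⟨fun y => (hg y).differentiableAt, ?_⟩
  have hsym := (hF.contDiffAt (x := x)).isSymmSndFDerivAt (by simp)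
  intro u v
  rw [(hg x).fderiv]
  have key : ∀ u v, inner ℝ ((InnerProductSpace.toDual ℝ (EuclideanSpace ℝ (Fin d))).symm (fderiv ℝ (fderiv ℝ F) x u)) v = fderiv ℝ (fderiv ℝ F) x u v := by
    intro u v
    exact InnerProductSpace.toDual_symm_apply
  have h1 := key u v
  have h2 := key v u
  rw [real_inner_comm] at h2
  have h3 := hsym.eq u v
  exact h1.trans (h3.trans h2.symm)

lemma spectral_choice {d : ℕ} (H : EuclideanSpace ℝ (Fin d) →L[ℝ] EuclideanSpace ℝ (Fin d))
    (hH : (H : EuclideanSpace ℝ (Fin d) →ₗ[ℝ] EuclideanSpace ℝ (Fin d)).IsSymmetric) (L γ : ℝ) (hL : 0 < L)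
    (hHL : ‖H‖ ≤ L)
    (hmineig : ∃ (lam : ℝ) (e : EuclideanSpace ℝ (Fin d)), ‖e‖ = 1 ∧
      H e = lam • e ∧ lam ≤ -γ) :
    ∃ (b : OrthonormalBasis (Fin d) ℝ (EuclideanSpace ℝ (Fin d))) (i : Fin d) (lm : ℝ),
      lm ≤ -γ ∧ -L ≤ lm ∧ H (b i) = lm • b i ∧ ∀ x, ‖x - (1 / L) • H x‖ ≤ (1 - lm / L) * ‖x‖ := by
  obtain ⟨lam, e, he, hlam, hle⟩ := hmineig
  have hn : Module.finrank ℝ (EuclideanSpace ℝ (Fin d)) = d := by simp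
  have hev : Module.End.HasEigenvalue (H : EuclideanSpace ℝ (Fin d) →ₗ[ℝ] EuclideanSpace ℝ (Fin d)) lam := by
    apply Module.End.hasEigenvalue_of_hasEigenvector (x := e)
    refine ⟨Module.End.mem_eigenspace_iff.2 hlam, ?_⟩
    rintro rfl; simp at he
  obtain ⟨j, hj⟩ := hH.exists_eigenvalues_eq hn hev
  set b := hH.eigenvectorBasis hn
  set ev := hH.eigenvalues hn
  have hb : ∀ k, H (b k) = ev k • b k := fun k => hH.apply_eigenvectorBasis hn k
  have hc : ∀ x k, b.repr (H x) k = ev k * b.repr x k := fun x k => hH.eigenvectorBasis_apply_self_apply hn x k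
  have habs : ∀ k, |ev k| ≤ L := by
    intro k
    have := H.le_opNorm (b k)
    rw [hb, norm_smul, b.norm_eq_one, mul_one, mul_one] at this
    exact this.trans hHL
  have : Nonempty (Fin d) := ⟨j⟩
  obtain ⟨i, hi⟩ := Finite.exists_min ev
  refine ⟨b, i, ev i, ?_, (abs_le.1 (habs i)).1, hb i, ?_⟩
  · have := hi j
    have hj' : ev j = lam := by simpa using hj
    linarith
  · intro x
    have hp : ∀ k, 0 ≤ 1 - ev k / L := by
      intro k
      have : ev k / L ≤ 1 := by rw [div_le_one hL]; exact (abs_le.1 (habs k)).2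
      linarith
    rw [← b.repr.norm_map, ← b.repr.norm_map x]
    rw [← abs_of_nonneg (hp i), ← Real.norm_eq_abs, ← norm_smul]
    rw [EuclideanSpace.norm_eq, EuclideanSpace.norm_eq]
    apply Real.sqrt_le_sqrt
    apply Finset.sum_le_sum
    intro k _
    have e1 : (b.repr (x - (1 / L) • H x)) k = (1 - ev k / L) * b.repr x k := by
      simp only [map_sub, map_smul, PiLp.sub_apply, PiLp.smul_apply, hc, smul_eq_mul]; ring
    rw [e1, PiLp.smul_apply, smul_eq_mul, norm_mul, norm_mul, Real.norm_of_nonneg (hp k), Real.norm_of_nonneg (hp i)]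
    have := hi k
    have := hp k
    gcongr

lemma growth (x T Q : ℝ) (hx0 : 0 < x) (hx1 : x ≤ 1) (hQ : 4 ≤ Q)
    (hT : T = 2 / x * Real.logb (9/4) Q) : 16 / 9 * Q ≤ (1 + x) ^ T := by
  have h2 : (2:ℝ) ≤ (1+x) ^ (1/x) := by
    have := one_add_mul_self_le_rpow_one_add (s := x) (by linarith) (p := 1/x) (by rw [le_div_iff₀ hx0]; linarith)
    have e : 1 / x * x = 1 := by field_simp
    rw [e] at this; linarith
  set l := Real.logb (9/4) Q with hl
  have hQl : (9/4:ℝ) ^ l = Q := Real.rpow_logb (by norm_num) (by norm_num) (by linarith)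
  have hl1 : 1 ≤ l := by
    rw [hl, Real.le_logb_iff_rpow_le (by norm_num) (by linarith), Real.rpow_one]; linarith
  have e : (1+x) ^ T = ((1+x)^(1/x)) ^ (2*l) := by
    rw [← Real.rpow_mul (by linarith), hT]; congr 1; ring
  rw [e]
  calc 16/9 * Q = (16/9:ℝ)^(1:ℝ) * (9/4:ℝ)^l := by rw [hQl, Real.rpow_one]
    _ ≤ (16/9:ℝ)^l * (9/4:ℝ)^l := by
      gcongr
      norm_num
    _ = (2:ℝ) ^ (2*l) := by
      rw [← Real.mul_rpow (by norm_num) (by norm_num), Real.rpow_mul (by norm_num)]; norm_num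
    _ ≤ _ := by gcongr

lemma dynamics {E : Type*} [NormedAddCommGroup E] [NormedSpace ℝ E] (A : E → E) (hAadd : ∀ x y, A (x + y) = A x + A y)
    (hAs : ∀ (s : ℝ) x, A (s • x) = s • A x)
    (a ε s : ℝ) (ha : 1 ≤ a) (hε : 0 ≤ ε) (hs : 0 < s) (e : E) (he : ‖e‖ = 1) (hAe : A e = a • e) (hA : ∀ x, ‖A x‖ ≤ a * ‖x‖)
    (T : ℕ) (hT : 7 / 2 * ε * T ≤ 7 / 24)
    (x : ℕ → E) (hx0 : x 0 = s • e) (hx : ∀ t < T, ‖x (t+1) - A (x t)‖ ≤ ε * ‖x t‖ + 2 * ε * s) :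
    ∀ t ≤ T, ‖x t - (a ^ t * s) • e‖ ≤ 7 / 2 * ε * t * (a ^ t * s) := by
  intro t
  induction t with
  | zero => intro _; simp [hx0]
  | succ t ih =>
    intro ht
    have ih := ih (by omega)
    have h := hx t (by omega)
    have hpow : 1 ≤ a ^ t := one_le_pow₀ ha
    set P := a ^ t * s with hP
    have hPs : s ≤ P := by rw [hP]; nlinarith
    have htT : (t:ℝ) ≤ T := by exact_mod_cast (by omega : t ≤ T)
    have hq : ‖x t - P • e‖ ≤ 1/2 * P := by
      refine ih.trans ?_
      have : 7/2 * ε * t ≤ 7/24 := le_trans (by gcongr) hT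
      gcongr; linarith
    have hxn : ‖x t‖ ≤ 3/2 * P := by
      have := norm_add_le (x t - P • e) (P • e)
      rw [sub_add_cancel, norm_smul, he, Real.norm_of_nonneg (by linarith)] at this
      linarith
    have hsplit : x (t+1) - (a^(t+1) * s) • e = (x (t+1) - A (x t)) + A (x t - P • e) := by
      have h1 : A (x t) = A (x t - P • e) + A (P • e) := by rw [← hAadd, sub_add_cancel]
      have h2 : A (P • e) = (a^(t+1)*s) • e := by
        rw [hAs, hAe, smul_smul]; congr 1; rw [hP]; ring
      rw [← h2]; rw [h1]; abel
    rw [hsplit]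
    have h3 := norm_add_le (x (t+1) - A (x t)) (A (x t - P • e))
    have h4 := hA (x t - P • e)
    have h5 : a * ‖x t - P • e‖ ≤ a * (7 / 2 * ε * t * P) := by gcongr
    have h6 : ε * ‖x t‖ ≤ ε * (3/2*P) := by gcongr
    have h7 : ε * s ≤ ε * P := by gcongr
    have h8 : ε * P ≤ a * (ε * P) := by
      have : 0 ≤ ε * P := by apply mul_nonneg hε; linarith
      nlinarith
    have h9 : 7/2*ε*((t+1:ℕ):ℝ) * (a^(t+1)*s) = a * (7 / 2 * ε * t * P) + 7/2 * (a * (ε * P)) := by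
      rw [hP]; push_cast; ring
    rw [h9]; linarith

lemma stuck_gap
    (d : ℕ) (F : EuclideanSpace ℝ (Fin d) → ℝ) (L ρ : ℝ)
    (hL : 0 < L) (hρ : 0 < ρ)
    (hdiff : Differentiable ℝ (gradient F))
    (hhess : ∀ x y : EuclideanSpace ℝ (Fin d),
      ‖fderiv ℝ (gradient F) x - fderiv ℝ (gradient F) y‖ ≤ ρ * ‖x - y‖)
    (wt : EuclideanSpace ℝ (Fin d)) (γ : ℝ) (hγ : 0 < γ)
    (e : EuclideanSpace ℝ (Fin d)) (lm : ℝ) (he : ‖e‖ = 1) (hlm : lm ≤ -γ) (hlmL : -L ≤ lm)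
    (hHe : fderiv ℝ (gradient F) wt e = lm • e)
    (hA : ∀ x, ‖x - (1 / L) • fderiv ℝ (gradient F) wt x‖ ≤ (1 - lm / L) * ‖x‖)
    (R r μ Δ : ℝ) (hR : 0 < R) (hr : 0 < r) (hμ : 0 < μ) (hμr : μ < r)
    (Tth : ℕ)
    (hTval : (Tth : ℝ) = 2 / ((1 / L) * γ) * Real.logb (9 / 4) (2 * (R + r) / μ))
    (hRμ : R ≥ μ) (hΔle : ρ * (R + r) * μ ≥ Δ)
    (hγge : γ ≥ 24 * ρ * (R + r) * Real.logb (9 / 4) (2 * (R + r) / μ))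
    (w v : ℕ → EuclideanSpace ℝ (Fin d)) (s : ℝ) (hs : μ ≤ s)
    (h0 : v 0 - w 0 = s • e)
    (hw0 : w 0 ∈ Metric.closedBall wt r) (hv0 : v 0 ∈ Metric.closedBall wt r)
    (hw : ∀ τ < Tth, ‖L • (w τ - w (τ + 1)) - gradient F (w τ)‖ ≤ Δ)
    (hv : ∀ τ < Tth, ‖L • (v τ - v (τ + 1)) - gradient F (v τ)‖ ≤ Δ)
    (hwR : ∀ t, ‖w t - w 0‖ ≤ R) (hvR : ∀ t, ‖v t - v 0‖ ≤ R) : False := by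
  set H := fderiv ℝ (gradient F) wt with hH
  have hball : ∀ u : ℕ → EuclideanSpace ℝ (Fin d), u 0 ∈ Metric.closedBall wt r →
      (∀ t, ‖u t - u 0‖ ≤ R) → ∀ t, u t ∈ Metric.closedBall wt (R + r) := by
    intro u hu0 hu t
    rw [mem_closedBall_iff_norm] at hu0 ⊢
    calc ‖u t - wt‖ = ‖(u t - u 0) + (u 0 - wt)‖ := by rw [sub_add_sub_cancel]
      _ ≤ _ := (norm_add_le _ _).trans (add_le_add (hu t) hu0)
  have hwB := hball w hw0 hwR
  have hvB := hball v hv0 hvR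
  set ε := ρ * (R + r) / L with hε
  have hεp : 0 ≤ ε := by positivity
  have hspos : 0 < s := by linarith
  have hQ : 4 ≤ 2 * (R + r) / μ := by rw [le_div_iff₀ hμ]; linarith
  set ℓ := Real.logb (9 / 4) (2 * (R + r) / μ) with hℓ
  have hdyn := dynamics (fun x => x - (1 / L) • H x)
    (by intro x y; simp only [map_add, smul_add]; abel)
    (by intro c x; simp only [map_smul, smul_sub]; rw [smul_comm])
    (1 - lm / L) ε s
    (by have : lm / L ≤ 0 := div_nonpos_of_nonpos_of_nonneg (by linarith) hL.le
        linarith)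
    hεp hspos e he
    (by simp only [hHe, smul_smul, sub_smul, one_smul]; congr 2; ring)
    hA Tth
    (by
      rw [hTval, hε]
      have e1 : 7 / 2 * (ρ * (R + r) / L) * (2 / (1 / L * γ) * ℓ) = 7 / 24 * (24 * ρ * (R + r) * ℓ) / γ := by
        field_simp
      rw [e1, div_le_iff₀ hγ]; linarith)
    (fun t => v t - w t) h0
    (by
      intro t ht
      have hmv := Convex.norm_image_sub_le_of_norm_fderiv_le' (𝕜 := ℝ) (f := gradient F) (φ := H)
        (C := ρ * (R + r)) (s := Metric.closedBall wt (R + r)) (fun x _ => hdiff x)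
        (by intro x hx
            refine (hhess x wt).trans ?_
            rw [mem_closedBall_iff_norm] at hx
            gcongr)
        (convex_closedBall _ _) (hwB t) (hvB t)
      have hw' := hw t ht
      have hv' := hv t ht
      have hid : (v (t+1) - w (t+1)) - ((v t - w t) - (1 / L) • H (v t - w t)) =
          (1 / L) • ((L • (w t - w (t + 1)) - gradient F (w t)) - (L • (v t - v (t + 1)) - gradient F (v t))
            - (gradient F (v t) - gradient F (w t) - H (v t - w t))) := by
        have hl : ∀ z : EuclideanSpace ℝ (Fin d), z = (1 / L) • (L • z) := by
          intro z; rw [smul_smul, one_div_mul_cancel hL.ne', one_smul]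
        rw [hl ((v (t+1) - w (t+1)) - ((v t - w t) - (1 / L) • H (v t - w t)))]
        congr 1
        rw [smul_sub, smul_sub L (v t - w t), smul_smul L, mul_one_div_cancel hL.ne', one_smul]
        simp only [smul_sub]
        abel
      rw [hid, norm_smul, Real.norm_of_nonneg (by positivity)]
      have h1 := norm_sub_le ((L • (w t - w (t + 1)) - gradient F (w t)) - (L • (v t - v (t + 1)) - gradient F (v t)))
        (gradient F (v t) - gradient F (w t) - H (v t - w t))
      have h2 := norm_sub_le (L • (w t - w (t + 1)) - gradient F (w t)) (L • (v t - v (t + 1)) - gradient F (v t))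
      have h3 : Δ ≤ ρ * (R + r) * s := hΔle.trans (by gcongr)
      calc _ ≤ 1 / L * (ρ * (R + r) * ‖v t - w t‖ + 2 * (ρ * (R + r) * s)) := by
            gcongr; linarith
        _ = _ := by rw [hε]; ring)
    Tth le_rfl
  set a := 1 - lm / L with ha
  have hγL : γ ≤ L := by linarith
  have hgrow := growth (1 / L * γ) Tth _ (by positivity) (by
    rw [one_div_mul_eq_div, div_le_one hL]; exact hγL) hQ hTval
  rw [Real.rpow_natCast] at hgrow
  have ha1 : 1 + 1 / L * γ ≤ a := by
    rw [ha]
    have : γ / L ≤ -lm / L := by gcongr; linarith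
    rw [neg_div] at this
    rw [one_div_mul_eq_div]; linarith
  have hpow : (1 + 1 / L * γ) ^ Tth ≤ a ^ Tth := by gcongr
  have hT7 : 7 / 2 * ε * Tth ≤ 7 / 24 := by
      rw [hTval, hε]
      have e1 : 7 / 2 * (ρ * (R + r) / L) * (2 / (1 / L * γ) * ℓ) = 7 / 24 * (24 * ρ * (R + r) * ℓ) / γ := by
        field_simp
      rw [e1, div_le_iff₀ hγ]; linarith
  have hapos : 0 < a := lt_of_lt_of_le (by positivity) ha1
  have hP : 16 / 9 * (2 * (R + r)) ≤ a ^ Tth * s := by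
    have h1 : 16 / 9 * (2 * (R + r) / μ) * μ ≤ a ^ Tth * s :=
      mul_le_mul (hgrow.trans hpow) hs hμ.le (by positivity)
    have h2 : 16 / 9 * (2 * (R + r) / μ) * μ = 16 / 9 * (2 * (R + r)) := by field_simp
    linarith
  have hup : ‖v Tth - w Tth‖ ≤ 2 * (R + r) := by
    have h1 := hwB Tth
    have h2 := hvB Tth
    rw [mem_closedBall_iff_norm] at h1 h2
    calc ‖v Tth - w Tth‖ = ‖(v Tth - wt) - (w Tth - wt)‖ := by rw [sub_sub_sub_cancel_right]
      _ ≤ _ := (norm_sub_le _ _).trans (by linarith)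
  have hlow := norm_sub_le (v Tth - w Tth) (v Tth - w Tth - (a ^ Tth * s) • e)
  rw [sub_sub_cancel, norm_smul, he, Real.norm_of_nonneg (by positivity), mul_one] at hlow
  have h7 : 7 / 2 * ε * Tth * (a ^ Tth * s) ≤ 7 / 24 * (a ^ Tth * s) := by gcongr
  linarith

/-- (Volume of the stuck region.) Near a point `w̃` where the Hessian of `F`
has an eigenvalue `≤ -γ < 0`, the stuck region — the set of starting points `w₀ ∈ B(w̃, r)`
from which some `Δ`-inexact gradient descent sequence with step `1/L` stays within distance
`R` of `w₀` for all `t ≤ T_th` — has Lebesgue measure at most `(2μ√d/r)` times the measure of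
the ball `B(w̃, r)`. -/
theorem stuck_region_volume
    (d : ℕ) (F : EuclideanSpace ℝ (Fin d) → ℝ) (L ρ : ℝ)
    (hL : 0 < L) (hρ : 0 < ρ)
    (hF : ContDiff ℝ 2 F)
    (hsmooth : ∀ x y : EuclideanSpace ℝ (Fin d),
      ‖gradient F x - gradient F y‖ ≤ L * ‖x - y‖)
    (hhess : ∀ x y : EuclideanSpace ℝ (Fin d),
      ‖fderiv ℝ (gradient F) x - fderiv ℝ (gradient F) y‖ ≤ ρ * ‖x - y‖)
    (wt : EuclideanSpace ℝ (Fin d)) (γ : ℝ) (hγ : 0 < γ)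
    (hmineig : ∃ (lam : ℝ) (e : EuclideanSpace ℝ (Fin d)), ‖e‖ = 1 ∧
      fderiv ℝ (gradient F) wt e = lam • e ∧ lam ≤ -γ)
    (R r μ Δ : ℝ) (hR : 0 < R) (hr : 0 < r) (hμ : 0 < μ) (hμr : μ < r) (hΔ : 0 ≤ Δ)
    (Tth : ℕ) (hTth : 0 < Tth)
    (hTval : (Tth : ℝ) = 2 / ((1 / L) * γ) * Real.logb (9 / 4) (2 * (R + r) / μ))
    (hRμ : R ≥ μ) (hΔle : ρ * (R + r) * μ ≥ Δ)
    (hγge : γ ≥ 24 * ρ * (R + r) * Real.logb (9 / 4) (2 * (R + r) / μ)) :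
    volume {w₀ : EuclideanSpace ℝ (Fin d) | w₀ ∈ Metric.closedBall wt r ∧
        ∃ w g : ℕ → EuclideanSpace ℝ (Fin d), w 0 = w₀ ∧
          (∀ τ < Tth, ‖g τ - gradient F (w τ)‖ ≤ Δ ∧
            w (τ + 1) = w τ - (1 / L) • g τ) ∧
          (∀ t ≤ Tth, ‖w t - w 0‖ < R)} ≤
      ENNReal.ofReal (2 * μ * Real.sqrt d / r) * volume (Metric.closedBall wt r) := by
  obtain ⟨hdiff, hsym⟩ := hess_symm F hF wt
  have hHL : ‖fderiv ℝ (gradient F) wt‖ ≤ L := by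
    apply norm_fderiv_le_of_lip' ℝ hL.le
    exact Filter.Eventually.of_forall fun x => hsmooth x wt
  obtain ⟨b, i, lm, hlm, hlmL, hHe, hA⟩ := spectral_choice _ hsym L γ hL hHL hmineig
  have hgc : Continuous (gradient F) := hdiff.continuous
  -- the compact set of (extended) trajectories
  set C : Set (ℕ → EuclideanSpace ℝ (Fin d)) := {w | w 0 ∈ Metric.closedBall wt r ∧
    (∀ τ, τ < Tth → ‖L • (w τ - w (τ + 1)) - gradient F (w τ)‖ ≤ Δ) ∧ ∀ t, ‖w t - w 0‖ ≤ R} with hC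
  have hCclosed : IsClosed C := by
    refine IsClosed.and ?_ (IsClosed.and ?_ ?_)
    · exact Metric.isClosed_closedBall.preimage (continuous_apply 0)
    · simp only [Set.ofPred_forall]
      refine isClosed_iInter fun τ => isClosed_iInter fun _ => ?_
      exact isClosed_le (by fun_prop) continuous_const
    · simp only [Set.ofPred_forall]
      refine isClosed_iInter fun τ => ?_
      exact isClosed_le (by fun_prop) continuous_const
  have hCcomp : IsCompact C := by
    refine (isCompact_univ_pi (s := fun _ : ℕ => Metric.closedBall wt (R + r))
      fun _ => isCompact_closedBall _ _).of_isClosed_subset hCclosed ?_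
    rintro w ⟨hw0, -, hwR⟩ t -
    rw [mem_closedBall_iff_norm] at hw0 ⊢
    calc ‖w t - wt‖ = ‖(w t - w 0) + (w 0 - wt)‖ := by rw [sub_add_sub_cancel]
      _ ≤ _ := (norm_add_le _ _).trans (add_le_add (hwR t) hw0)
  set K := (fun w : ℕ → EuclideanSpace ℝ (Fin d) => w 0) '' C with hKdef
  have hKm : MeasurableSet K := (hCcomp.image (continuous_apply 0)).isClosed.measurableSet
  have hsub : {w₀ : EuclideanSpace ℝ (Fin d) | w₀ ∈ Metric.closedBall wt r ∧
        ∃ w g : ℕ → EuclideanSpace ℝ (Fin d), w 0 = w₀ ∧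
          (∀ τ < Tth, ‖g τ - gradient F (w τ)‖ ≤ Δ ∧
            w (τ + 1) = w τ - (1 / L) • g τ) ∧
          (∀ t ≤ Tth, ‖w t - w 0‖ < R)} ⊆ K := by
    rintro w₀ ⟨hw₀, w, g, rfl, hg, hwR⟩
    refine ⟨fun t => w (min t Tth), ⟨by simpa using hw₀, ?_, ?_⟩, by simp⟩
    · intro τ hτ
      obtain ⟨h1, h2⟩ := hg τ hτ
      have e1 : min τ Tth = τ := by omega
      have e2 : min (τ + 1) Tth = τ + 1 := by omega
      simp only [e1, e2]
      rw [h2, sub_sub_cancel, smul_smul, mul_one_div_cancel hL.ne', one_smul]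
      exact h1
    · intro t
      simpa using (hwR (min t Tth) (min_le_right _ _)).le
  refine (measure_mono hsub).trans ?_
  have hgapK : ∀ (s : ℝ), μ ≤ s → ∀ x ∈ K, ∀ y ∈ K, y - x = s • b i → False := by
    rintro s hs _ ⟨w, ⟨hw0, hw, hwR⟩, rfl⟩ _ ⟨v, ⟨hv0, hv, hvR⟩, rfl⟩ hxy
    exact stuck_gap d F L ρ hL hρ hdiff hhess wt γ hγ (b i) lm (b.norm_eq_one i) hlm hlmL hHe hA
      R r μ Δ hR hr hμ hμr Tth hTval hRμ hΔle hγge w v s hs hxy hw0 hv0 hw hv hwR hvR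
  have hvol : volume (b.repr.symm ⁻¹' K) = volume K :=
    b.measurePreserving_repr_symm.measure_preimage hKm.nullMeasurableSet
  obtain ⟨n, rfl⟩ : ∃ n, d = n + 1 := ⟨d - 1, by have := i.2; omega⟩
  have hslab := slab_bound n (b.repr.symm ⁻¹' K) (b.repr.symm.continuous.measurable hKm) i (b.repr wt) r μ
    (by
      rintro x ⟨w, ⟨hw0, -, -⟩, hwx⟩
      rw [mem_closedBall_iff_norm] at hw0 ⊢
      have e1 : x = b.repr (w 0) := by
        have : w 0 = b.repr.symm x := hwx
        rw [this, LinearIsometryEquiv.apply_symm_apply]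
      rw [e1, ← map_sub, LinearIsometryEquiv.norm_map]
      exact hw0)
    (by
      intro x hx y hy hxy
      have hd : ∀ x y : EuclideanSpace ℝ (Fin (n+1)), (∀ j, j ≠ i → x j = y j) →
          b.repr.symm y - b.repr.symm x = (y i - x i) • b i := by
        intro x y hxy
        rw [← map_sub, ← b.repr_symm_single, ← map_smul]
        congr 1
        ext j
        by_cases hj : j = i
        · subst hj; simp
        · simp [hj, hxy j hj]
      by_contra hcon
      push Not at hcon
      rcases lt_abs.1 hcon with h | h
      · exact hgapK (x i - y i) h.le _ hy _ hx (hd y x fun j hj => (hxy j hj).symm)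
      · exact hgapK (y i - x i) (by linarith) _ hx _ hy (hd x y hxy))
  rw [hvol] at hslab
  refine hslab.trans ?_
  refine (mul_le_mul_right (ball_ratio n r hr wt) _).trans ?_
  rw [← mul_assoc, ← ENNReal.ofReal_mul hμ.le]
  apply le_of_eq
  congr 2
  ring
end

section
/- Let e be a unit vector in ℝ^d with d ≥ 2, let B(w̃, r) be a closed Euclidean ball, and let S ⊆ B(w̃, r) be a measurable set with the property that any two points x, y ∈ S with y − x parallel to e satisfy ‖y − x‖ ≤ 2μ. Then the d-dimensional Lebesgue measure of S is at most 2μ times the (d−1)-dimensional volume of the Euclidean ball of radius r in ℝ^{d−1}. -/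
open MeasureTheory

theorem thin_chord_set_volume
    (d : ℕ) (hd : 2 ≤ d) (r μ : ℝ) (hr : 0 < r)
    (wt e : EuclideanSpace ℝ (Fin d)) (he : ‖e‖ = 1)
    (S : Set (EuclideanSpace ℝ (Fin d))) (hSmeas : MeasurableSet S)
    (hSsub : S ⊆ Metric.closedBall wt r)
    (hchord : ∀ x ∈ S, ∀ y ∈ S, (∃ c : ℝ, y - x = c • e) → ‖y - x‖ ≤ 2 * μ) :
    volume S ≤ ENNReal.ofReal (2 * μ *
      (Real.pi ^ (((d : ℝ) - 1) / 2) * r ^ ((d : ℝ) - 1) /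
        Real.Gamma (((d : ℝ) - 1) / 2 + 1))) := by
  rcases S.eq_empty_or_nonempty with rfl | ⟨x0, hx0⟩
  · simp
  have hμ : 0 ≤ 2 * μ := by simpa using hchord x0 hx0 x0 hx0 ⟨0, by simp⟩
  obtain ⟨n, rfl⟩ : ∃ n, d = n + 1 := ⟨d - 1, by omega⟩
  have he0 : e ≠ 0 := by
    rintro rfl
    simp at he
  let F : Submodule ℝ (EuclideanSpace ℝ (Fin (n + 1))) := (Submodule.span ℝ {e})ᗮ
  have hFact : Fact (Module.finrank ℝ (EuclideanSpace ℝ (Fin (n + 1))) = n + 1) := ⟨by simp⟩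
  have hF : Module.finrank ℝ F = n := Submodule.finrank_orthogonal_span_singleton he0
  have : Nontrivial F := Module.nontrivial_of_finrank_pos (R := ℝ) (by omega)
  let L0 : WithLp 2 (F × ℝ) →ₗ[ℝ] EuclideanSpace ℝ (Fin (n + 1)) :=
    { toFun := fun p => (p.fst : EuclideanSpace ℝ (Fin (n + 1))) + p.snd • e
      map_add' := by
        intro p q
        simp only [WithLp.add_fst, WithLp.add_snd, Submodule.coe_add]
        module
      map_smul' := by
        intro c p
        simp only [WithLp.smul_fst, WithLp.smul_snd, Submodule.coe_smul, RingHom.id_apply, smul_eq_mul]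
        module }
  let L1 : WithLp 2 (F × ℝ) →ₗᵢ[ℝ] EuclideanSpace ℝ (Fin (n + 1)) :=
    { L0 with
      norm_map' := by
        intro p
        change ‖(p.fst : EuclideanSpace ℝ (Fin (n + 1))) + p.snd • e‖ = ‖p‖
        have horth : inner ℝ (p.fst : EuclideanSpace ℝ (Fin (n + 1))) (p.snd • e) = 0 := by
          rw [inner_smul_right, Submodule.mem_orthogonal_singleton_iff_inner_left.1 p.fst.2, mul_zero]
        have h1 := norm_add_sq_eq_norm_sq_add_norm_sq_real horth
        have h2 := WithLp.prod_norm_sq_eq_of_L2 p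
        rw [← sq_eq_sq₀ (norm_nonneg _) (norm_nonneg _), h2, sq, h1, norm_smul, he]
        simp [sq] }
  have hfin : Module.finrank ℝ (WithLp 2 (F × ℝ)) =
      Module.finrank ℝ (EuclideanSpace ℝ (Fin (n + 1))) := by
    rw [(WithLp.linearEquiv 2 ℝ (F × ℝ)).finrank_eq, Module.finrank_prod, hF]
    simp
  let L := L1.toLinearIsometryEquiv hfin
  have hL : ∀ p, L p = (p.fst : EuclideanSpace ℝ (Fin (n + 1))) + p.snd • e := fun p => rfl
  have hmp : MeasurePreserving (fun p : F × ℝ => L (WithLp.toLp 2 p)) :=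
    L.measurePreserving.comp (WithLp.volume_preserving_toLp F ℝ)
  rw [← hmp.measure_preimage hSmeas.nullMeasurableSet]
  have hS' := hmp.measurable hSmeas
  rw [Measure.volume_eq_prod, Measure.prod_apply hS']
  set a : F := (L.symm wt).fst with ha
  have key : ∀ w : F, volume (Prod.mk w ⁻¹' ((fun p : F × ℝ => L (WithLp.toLp 2 p)) ⁻¹' S)) ≤
      (Metric.closedBall a r).indicator (fun _ => ENNReal.ofReal (2 * μ)) w := by
    intro w
    by_cases hw : w ∈ Metric.closedBall a r
    · rw [Set.indicator_of_mem hw]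
      refine (Real.volume_le_diam _).trans (Metric.ediam_le fun s hs t ht => ?_)
      have h3 : L (WithLp.toLp 2 (w, s)) - L (WithLp.toLp 2 (w, t)) = (s - t) • e := by
        change ((w : EuclideanSpace ℝ (Fin (n + 1))) + s • e) - (w + t • e) = (s - t) • e
        module
      have h : ‖L (WithLp.toLp 2 (w, s)) - L (WithLp.toLp 2 (w, t))‖ ≤ 2 * μ :=
        hchord _ ht _ hs ⟨s - t, h3⟩
      rw [edist_dist]
      apply ENNReal.ofReal_le_ofReal
      rw [h3, norm_smul, he, mul_one] at h
      exact h
    · rw [Set.indicator_of_notMem hw, nonpos_iff_eq_zero]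
      convert measure_empty (μ := (volume : Measure ℝ))
      refine Set.eq_empty_of_forall_notMem fun t ht => hw ?_
      have h := hSsub ht
      rw [Metric.mem_closedBall, dist_eq_norm] at h ⊢
      rw [← L.apply_symm_apply wt, ← map_sub, L.norm_map] at h
      have h2 := WithLp.prod_norm_sq_eq_of_L2 (WithLp.toLp 2 (w, t) - L.symm wt)
      refine le_trans ?_ h
      refine le_of_sq_le_sq ?_ (norm_nonneg _)
      rw [h2]
      have : (WithLp.toLp 2 (w, t) - L.symm wt).fst = w - a := rfl
      rw [this]
      nlinarith [sq_nonneg ‖(WithLp.toLp 2 (w, t) - L.symm wt).snd‖]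
  refine (lintegral_mono key).trans ?_
  rw [lintegral_indicator_const Metric.isClosed_closedBall.measurableSet,
    InnerProductSpace.volume_closedBall, hF, ← ENNReal.ofReal_pow hr.le, ← ENNReal.ofReal_mul (by positivity),
    ← ENNReal.ofReal_mul hμ]
  apply le_of_eq
  congr 2
  have h1 : ((n + 1 : ℕ) : ℝ) - 1 = n := by push_cast; ring
  have h2 : Real.pi ^ ((n : ℝ) / 2) = √Real.pi ^ n := by
    rw [Real.sqrt_eq_rpow, ← Real.rpow_natCast, ← Real.rpow_mul Real.pi_pos.le]
    congr 1
    ring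
  rw [h1, h2, Real.rpow_natCast]
  ring
end

section
/- For every real x ≥ 0, Γ(x + 1)/Γ(x + 1/2) < √(x + 1/2), where Γ is the Gamma function. -/
/-- For every real `x ≥ 0`, `Γ(x+1)/Γ(x+1/2) < √(x+1/2)`. -/
theorem gamma_ratio_lt_sqrt (x : ℝ) (hx : 0 ≤ x) :
    Real.Gamma (x + 1) / Real.Gamma (x + 1 / 2) < Real.sqrt (x + 1 / 2) := by
  have hA : 0 < Real.Gamma (x + 1) := Real.Gamma_pos_of_pos (by linarith)
  have hB : 0 < Real.Gamma (x + 1 / 2) := Real.Gamma_pos_of_pos (by linarith)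
  have h := Real.Gamma_mul_add_mul_le_rpow_Gamma_mul_rpow_Gamma
    (s := x + 1 / 2 + 1) (t := x + 1 / 2 + 1 + 1) (a := 1 / 2) (b := 1 / 2)
    (by linarith) (by linarith) (by norm_num) (by norm_num) (by norm_num)
  have e : 1 / 2 * (x + 1 / 2 + 1) + 1 / 2 * (x + 1 / 2 + 1 + 1) = x + 1 + 1 := by ring
  rw [e, Real.Gamma_add_one (s := x + 1) (by linarith),
    Real.Gamma_add_one (s := x + 1 / 2 + 1) (by linarith),
    Real.Gamma_add_one (s := x + 1 / 2) (by linarith),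
    ← Real.sqrt_eq_rpow, ← Real.sqrt_eq_rpow, ← Real.sqrt_mul (by positivity)] at h
  have h2 := (Real.le_sqrt (by positivity) (by positivity)).1 h
  generalize Real.Gamma (x + 1) = A at *
  generalize Real.Gamma (x + 1 / 2) = B at *
  apply Real.lt_sqrt_of_sq_lt
  rw [div_pow, div_lt_iff₀ (by positivity)]
  have h3 : 0 < (x + 1 / 2) * B ^ 2 := by positivity
  have h4 : (x + 1) ^ 2 * A ^ 2 < (x + 1) ^ 2 * ((x + 1 / 2) * B ^ 2) := by nlinarith
  exact lt_of_mul_lt_mul_left h4 (by positivity)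
end

section
/- Fix Δ ∈ (0, 1] and for each s ∈ ℝ define f_s : ℝ → ℝ by f_s(w) = Δ^{3/2}·sin(Δ^{−1/2}·w + s). Then: (i) every f_s is 1-smooth and 1-Hessian-Lipschitz; (ii) |f_s'(w)| ≤ Δ for all s, w ∈ ℝ, so the identically-zero function is a Δ-inexact gradient oracle for every f_s simultaneously; and (iii) for every point w̃ ∈ ℝ there exists s ∈ ℝ with |f_s'(w̃)| = Δ/√2 > Δ/2 and f_s''(w̃) = −Δ^{1/2}/√2 < −Δ^{1/2}/2. -/
theorem lip_one_aux (g g' : ℝ → ℝ) (hg : ∀ x, HasDerivAt g (g' x) x)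
    (hb : ∀ x, |g' x| ≤ 1) (w w' : ℝ) : |g w - g w'| ≤ 1 * |w - w'| := by
  have := Convex.norm_image_sub_le_of_norm_hasDerivWithin_le (f := g) (f' := g') (C := 1)
    (s := Set.univ) (fun x _ => (hg x).hasDerivWithinAt) (fun x _ => by simpa using hb x)
    convex_univ (Set.mem_univ w') (Set.mem_univ w)
  simpa using this

/-- (Lower bound construction.) For `Δ ∈ (0,1]` the family
`f_s(w) = Δ^{3/2} sin(Δ^{-1/2} w + s)` consists of 1-smooth, 1-Hessian-Lipschitz functions
whose derivatives are uniformly at most `Δ` (so the zero function is a `Δ`-inexact gradient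
oracle for all of them simultaneously), yet for every point some member has
derivative of absolute value `Δ/√2 > Δ/2` and second derivative `-√Δ/√2 < -√Δ/2` there. -/
theorem inexact_oracle_second_order_lower_bound
    (Δ : ℝ) (hΔ : 0 < Δ) (hΔ1 : Δ ≤ 1)
    (f : ℝ → ℝ → ℝ)
    (hf : ∀ s w, f s w = Δ ^ ((3 : ℝ) / 2) * Real.sin (w / Real.sqrt Δ + s)) :
    (∀ s : ℝ, Differentiable ℝ (f s) ∧ Differentiable ℝ (deriv (f s)) ∧
      (∀ w w' : ℝ, |deriv (f s) w - deriv (f s) w'| ≤ 1 * |w - w'|) ∧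
      (∀ w w' : ℝ, |deriv (deriv (f s)) w - deriv (deriv (f s)) w'| ≤ 1 * |w - w'|)) ∧
    (∀ s w : ℝ, |(0 : ℝ) - deriv (f s) w| ≤ Δ) ∧
    (∀ w₀ : ℝ, ∃ s : ℝ,
      |deriv (f s) w₀| = Δ / Real.sqrt 2 ∧ Δ / Real.sqrt 2 > Δ / 2 ∧
      deriv (deriv (f s)) w₀ = -(Real.sqrt Δ / Real.sqrt 2) ∧
      -(Real.sqrt Δ / Real.sqrt 2) < -(Real.sqrt Δ / 2)) := by
  obtain ⟨r, hr⟩ : ∃ r, r = Real.sqrt Δ := ⟨_, rfl⟩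
  have hr0 : 0 < r := hr ▸ Real.sqrt_pos.mpr hΔ
  have hr2 : Δ = r ^ 2 := by rw [hr, Real.sq_sqrt hΔ.le]
  have hr1 : r ≤ 1 := by rw [hr]; exact Real.sqrt_le_one.mpr hΔ1
  have hpow : Δ ^ ((3 : ℝ) / 2) = r ^ 3 := by
    rw [hr, Real.sqrt_eq_rpow, ← Real.rpow_natCast, ← Real.rpow_mul hΔ.le]
    norm_num
  rw [← hr]
  rw [← hr, hpow] at hf
  have hin : ∀ s w : ℝ, HasDerivAt (fun w : ℝ => w / r + s) (1 / r) w := fun s w =>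
    ((hasDerivAt_id w).div_const r).add_const s
  have h1 : ∀ s w, HasDerivAt (f s) (Δ * Real.cos (w / r + s)) w := by
    intro s w
    have h := ((hin s w).sin).const_mul (r ^ 3)
    rw [funext (hf s)]
    refine h.congr_deriv ?_
    rw [hr2]; field_simp
  have d1 : ∀ s, deriv (f s) = fun w => Δ * Real.cos (w / r + s) :=
    fun s => funext fun w => (h1 s w).deriv
  have h2 : ∀ s w, HasDerivAt (deriv (f s)) (-(r * Real.sin (w / r + s))) w := by
    intro s w
    have h := ((hin s w).cos).const_mul Δ
    rw [d1 s]
    refine h.congr_deriv ?_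
    rw [hr2]; field_simp
  have d2 : ∀ s, deriv (deriv (f s)) = fun w => -(r * Real.sin (w / r + s)) :=
    fun s => funext fun w => (h2 s w).deriv
  have h3 : ∀ s w, HasDerivAt (deriv (deriv (f s))) (-Real.cos (w / r + s)) w := by
    intro s w
    have h := (((hin s w).sin).const_mul r).neg
    rw [d2 s]
    refine h.congr_deriv ?_
    field_simp
  have hs2 : 0 < Real.sqrt 2 := by positivity
  have hs22 : Real.sqrt 2 * Real.sqrt 2 = 2 := Real.mul_self_sqrt (by norm_num)
  have hlt : Real.sqrt 2 < 2 := by nlinarith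
  have hq : Real.sqrt 2 / 2 = 1 / Real.sqrt 2 := by
    field_simp; nlinarith
  refine ⟨fun s => ⟨fun w => (h1 s w).differentiableAt, fun w => (h2 s w).differentiableAt,
    lip_one_aux _ _ (h2 s) ?_, lip_one_aux _ _ (h3 s) ?_⟩, ?_, ?_⟩
  · intro x
    rw [abs_neg, abs_mul, abs_of_pos hr0]
    exact mul_le_one₀ hr1 (abs_nonneg _) (Real.abs_sin_le_one _)
  · intro x
    rw [abs_neg]
    exact Real.abs_cos_le_one _
  · intro s w
    rw [d1, zero_sub, abs_neg, abs_mul, abs_of_pos hΔ]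
    exact mul_le_of_le_one_right hΔ.le (Real.abs_cos_le_one _)
  · intro w
    refine ⟨Real.pi / 4 - w / r, ?_, ?_, ?_, ?_⟩
    · rw [d1]
      simp only [add_sub_cancel, Real.cos_pi_div_four]
      rw [hq, mul_one_div, abs_of_pos (by positivity)]
    · exact div_lt_div_of_pos_left hΔ hs2 hlt
    · rw [d2]
      simp only [add_sub_cancel, Real.sin_pi_div_four]
      rw [hq, mul_one_div]
    · exact neg_lt_neg (div_lt_div_of_pos_left hr0 hs2 hlt)
end

section
/- Let λ > 0, Δ > 0, and define F : ℝ² → ℝ by F(w) = (1/2)w₁² − (λ/2)w₂², so ∇F(w) = (w₁, −λw₂). Define ĝ : ℝ² → ℝ² by ĝ(w) = (w₁, 0). Then: (i) ‖ĝ(w) − ∇F(w)‖ ≤ Δ whenever |w₂| ≤ Δ/λ; (ii) for any step size η ∈ (0, 2), the iteration w_{t+1} = w_t − η·ĝ(w_t) satisfies w_{t,2} = w_{0,2} and |w_{t,1}| ≤ |w_{0,1}| for all t; consequently, if w_0 lies in the ball B(0, r) and |w_{0,2}| ≤ Δ/λ, then all iterates w_t remain in B(0, r). -/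
/-- For the quadratic saddle `F(w) = (1/2)w₁² − (λ/2)w₂²` on `ℝ²`
(whose gradient is `(w₁, −λw₂)`), the adversarial estimate `ĝ(w) = (w₁, 0)` is `Δ`-inexact
whenever `|w₂| ≤ Δ/λ`, and the iteration `w_{t+1} = w_t − η·ĝ(w_t)` with `η ∈ (0,2)` keeps
the second coordinate fixed and shrinks the first; hence iterates started in `B(0,r)` with
`|w_{0,2}| ≤ Δ/λ` remain in `B(0,r)` forever. -/
theorem inexact_gd_stuck_at_saddle
    (l Δ : ℝ) (hl : 0 < l) (hΔ : 0 < Δ)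
    (F : EuclideanSpace ℝ (Fin 2) → ℝ)
    (hF : ∀ v : EuclideanSpace ℝ (Fin 2), F v = 1 / 2 * (v 0) ^ 2 - l / 2 * (v 1) ^ 2)
    (g : EuclideanSpace ℝ (Fin 2) → EuclideanSpace ℝ (Fin 2))
    (hg : ∀ v, g v 0 = v 0 ∧ g v 1 = 0) :
    (∀ v : EuclideanSpace ℝ (Fin 2),
      gradient F v 0 = v 0 ∧ gradient F v 1 = -l * v 1) ∧
    (∀ v : EuclideanSpace ℝ (Fin 2), |v 1| ≤ Δ / l → ‖g v - gradient F v‖ ≤ Δ) ∧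
    (∀ (η : ℝ), 0 < η → η < 2 →
      ∀ w : ℕ → EuclideanSpace ℝ (Fin 2),
        (∀ t, w (t + 1) = w t - η • g (w t)) →
        (∀ t, w t 1 = w 0 1 ∧ |w t 0| ≤ |w 0 0|) ∧
        (∀ r : ℝ, 0 < r → w 0 ∈ Metric.closedBall 0 r → |w 0 1| ≤ Δ / l →
          ∀ t, w t ∈ Metric.closedBall 0 r)) := by
  have hgrad : ∀ v : EuclideanSpace ℝ (Fin 2), gradient F v = !₂[v 0, -l * v 1] := by
    intro v
    apply HasGradientAt.gradient
    rw [hasGradientAt_iff_hasFDerivAt]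
    have hF' : F = fun v : EuclideanSpace ℝ (Fin 2) =>
        1 / 2 * (v 0) ^ 2 - l / 2 * (v 1) ^ 2 := funext hF
    rw [hF']
    have h0 : HasFDerivAt (fun v : EuclideanSpace ℝ (Fin 2) => v 0)
        (EuclideanSpace.proj 0 : EuclideanSpace ℝ (Fin 2) →L[ℝ] ℝ) v :=
      (EuclideanSpace.proj 0 : EuclideanSpace ℝ (Fin 2) →L[ℝ] ℝ).hasFDerivAt
    have h1 : HasFDerivAt (fun v : EuclideanSpace ℝ (Fin 2) => v 1)
        (EuclideanSpace.proj 1 : EuclideanSpace ℝ (Fin 2) →L[ℝ] ℝ) v :=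
      (EuclideanSpace.proj 1 : EuclideanSpace ℝ (Fin 2) →L[ℝ] ℝ).hasFDerivAt
    have h := ((h0.pow 2).const_mul (1 / 2)).sub ((h1.pow 2).const_mul (l / 2))
    refine h.congr_fderiv ?_
    ext x
    simp [InnerProductSpace.toDual_apply_apply, PiLp.inner_apply, Fin.sum_univ_two]
    ring
  refine ⟨fun v => by simp [hgrad], fun v hv => ?_, ?_⟩
  · rw [hgrad, EuclideanSpace.norm_eq, Fin.sum_univ_two]
    rw [le_div_iff₀ hl] at hv
    apply Real.sqrt_le_iff.mpr ⟨hΔ.le, ?_⟩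
    simp only [PiLp.sub_apply, (hg v).1, (hg v).2, Real.norm_eq_abs, sq_abs]
    simp
    rw [← sq_abs, abs_mul, abs_of_pos hl]
    gcongr
    linarith
  · intro η h0 h2 w hw
    have key : ∀ t, w t 1 = w 0 1 ∧ |w t 0| ≤ |w 0 0| := by
      intro t
      induction t with
      | zero => simp
      | succ t ih =>
        rw [hw t]
        simp only [PiLp.sub_apply, PiLp.smul_apply, (hg (w t)).1, (hg (w t)).2, smul_eq_mul]
        refine ⟨by simpa using ih.1, le_trans ?_ ih.2⟩
        have : w t 0 - η * w t 0 = (1 - η) * w t 0 := by ring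
        rw [this, abs_mul]
        exact mul_le_of_le_one_left (abs_nonneg _) (abs_le.mpr ⟨by linarith, by linarith⟩)
    refine ⟨key, fun r hr hb _ t => ?_⟩
    rw [mem_closedBall_zero_iff] at hb ⊢
    refine le_trans ?_ hb
    rw [EuclideanSpace.norm_eq, EuclideanSpace.norm_eq, Fin.sum_univ_two, Fin.sum_univ_two]
    apply Real.sqrt_le_sqrt
    simp only [Real.norm_eq_abs]
    rw [(key t).1]
    have := (key t).2
    gcongr
end
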